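/- Let p be an odd prime and let G be a finite group with center Z such that G/Z is isomorphic to the nonabelian group presented by ⟨x, y | x^{p²} = y^{p²} = 1, y x = x^{p+1} y⟩. Then p divides |Z|, and for every x ∈ G \ Z the conjugacy class x^G has cardinality p or p². -/

import Mathlib

/-- Relators of the group `L₂ = ⟨x, y | x^(p²) = y^(p²) = 1, y x = x^(p+1) y⟩`,
where `x` is the generator `0` and `y` is the generator `1`. -/
def L2Rels (p : ℕ) : Set (FreeGroup (Fin 2)) :=
  {FreeGroup.of 0 ^ p ^ 2, FreeGroup.of 1 ^ p ^ 2,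
    FreeGroup.of 1 * FreeGroup.of 0 * (FreeGroup.of 0 ^ (p + 1) * FreeGroup.of 1)⁻¹}

/-- The nonabelian group `L₂` presented by
`⟨x, y | x^(p²) = y^(p²) = 1, y x = x^(p+1) y⟩`. -/
def L2 (p : ℕ) : Type := PresentedGroup (L2Rels p)

instance (p : ℕ) : Group (L2 p) := by unfold L2; infer_instance

/-- If `n ^ 2 = 0`, then powers of `1 + n` are linear in the exponent. -/
lemma one_add_pow_of_sq_eq_zero {R : Type*} [CommRing R] {n : R} (hn : n ^ 2 = 0) (k : ℕ) :
    (1 + n) ^ k = 1 + k * n := by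
  induction k with
  | zero => simp
  | succ k ih =>
    rw [pow_succ, ih]
    push_cast
    linear_combination (k : R) * hn

lemma pow_mul_pow_of_mul_eq {L : Type*} [Group L] {x y : L} {r : ℕ} (h : y * x = x ^ r * y)
    (a b : ℕ) : y ^ b * x ^ a = x ^ (a * r ^ b) * y ^ b := by
  have h1 : ∀ a, y * x ^ a = x ^ (a * r) * y := fun a => by
    have : SemiconjBy y x (x ^ r) := h
    have := this.pow_right a
    rwa [← pow_mul, mul_comm r a] at this
  induction b with
  | zero => simp
  | succ b ih =>
    rw [pow_succ', mul_assoc, ih, ← mul_assoc, h1, mul_assoc, pow_succ, mul_assoc]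

/-- In a group generated by two torsion elements `x`, `y` with `y * x = x ^ r * y`, every element
has the form `x ^ a * y ^ b`. -/
lemma exists_eq_pow_mul_pow {L : Type*} [Group L] {x y : L} {r n : ℕ} (h : y * x = x ^ r * y)
    (hn : 0 < n) (hx : x ^ n = 1) (hy : y ^ n = 1) (hgen : Subgroup.closure {x, y} = ⊤) (g : L) :
    ∃ a < n, ∃ b < n, g = x ^ a * y ^ b := by
  suffices ∃ a b : ℕ, g = x ^ a * y ^ b by
    obtain ⟨a, b, rfl⟩ := this
    exact ⟨a % n, Nat.mod_lt _ hn, b % n, Nat.mod_lt _ hn, by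
      rw [pow_eq_pow_mod a hx, pow_eq_pow_mod b hy]⟩
  have hmul : ∀ a b c d : ℕ, ∃ i j : ℕ, (x ^ a * y ^ b) * (x ^ c * y ^ d) = x ^ i * y ^ j :=
    fun a b c d => ⟨a + c * r ^ b, b + d, by
      rw [pow_add, pow_add, mul_assoc, ← mul_assoc (y ^ b), pow_mul_pow_of_mul_eq h]
      simp only [mul_assoc]⟩
  have hinv : ∀ {z : L} (_ : z ^ n = 1) (a : ℕ), (z ^ a)⁻¹ = z ^ (a * (n - 1)) := by
    intro z hz a
    rw [inv_eq_iff_mul_eq_one, ← pow_add]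
    have : a + a * (n - 1) = n * a := by
      obtain ⟨m, rfl⟩ : ∃ m, n = m + 1 := ⟨n - 1, by omega⟩
      simp; ring
    rw [this, pow_mul, hz, one_pow]
  have hg : g ∈ Subgroup.closure {x, y} := hgen ▸ Subgroup.mem_top g
  induction hg using Subgroup.closure_induction with
  | mem z hz =>
    rcases hz with rfl | rfl
    · exact ⟨1, 0, by simp⟩
    · exact ⟨0, 1, by simp⟩
  | one => exact ⟨0, 0, by simp⟩
  | mul z w _ _ hz hw =>
    obtain ⟨a, b, rfl⟩ := hz
    obtain ⟨c, d, rfl⟩ := hw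
    exact hmul a b c d
  | inv z _ hz =>
    obtain ⟨a, b, rfl⟩ := hz
    obtain ⟨i, j, hij⟩ := hmul 0 (b * (n - 1)) (a * (n - 1)) 0
    refine ⟨i, j, ?_⟩
    rw [mul_inv_rev, hinv hx, hinv hy, ← hij]
    simp

namespace L2

variable {p : ℕ}

/-- The generator `x` of `L2 p`. -/
def x (p : ℕ) : L2 p := PresentedGroup.of (rels := L2Rels p) 0

/-- The generator `y` of `L2 p`. -/
def y (p : ℕ) : L2 p := PresentedGroup.of (rels := L2Rels p) 1

lemma x_pow : x p ^ p ^ 2 = 1 :=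
  PresentedGroup.one_of_mem (rels := L2Rels p) (x := FreeGroup.of 0 ^ p ^ 2) (by simp [L2Rels])

lemma y_pow : y p ^ p ^ 2 = 1 :=
  PresentedGroup.one_of_mem (rels := L2Rels p) (x := FreeGroup.of 1 ^ p ^ 2) (by simp [L2Rels])

lemma y_mul_x : y p * x p = x p ^ (p + 1) * y p :=
  mul_inv_eq_one.mp (PresentedGroup.one_of_mem (rels := L2Rels p)
    (x := FreeGroup.of 1 * FreeGroup.of 0 * (FreeGroup.of 0 ^ (p + 1) * FreeGroup.of 1)⁻¹)
    (by simp [L2Rels]))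

lemma closure_eq_top : Subgroup.closure {x p, y p} = ⊤ := by
  have h : Subgroup.closure (Set.range (PresentedGroup.of (rels := L2Rels p))) = ⊤ :=
    PresentedGroup.closure_range_of _
  have hr : Set.range (PresentedGroup.of (rels := L2Rels p)) = {x p, y p} := by
    ext z
    rw [Set.mem_range, Fin.exists_fin_two]
    exact or_congr eq_comm eq_comm
  rw [hr] at h
  exact h

/-- The universal property of `L2 p`. -/
lemma exists_hom {H : Type*} [Group H] {u v : H} (hu : u ^ p ^ 2 = 1) (hv : v ^ p ^ 2 = 1)
    (huv : v * u = u ^ (p + 1) * v) : ∃ f : L2 p →* H, f (x p) = u ∧ f (y p) = v := by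
  have h : ∀ r ∈ L2Rels p, FreeGroup.lift ![u, v] r = 1 := by
    rintro r (rfl | rfl | rfl)
    · simpa using hu
    · simpa using hv
    · simp [huv]
  exact ⟨PresentedGroup.toGroup h, PresentedGroup.toGroup.of h, PresentedGroup.toGroup.of h⟩

lemma exists_eq (hp : p.Prime) (g : L2 p) :
    ∃ a < p ^ 2, ∃ b < p ^ 2, g = x p ^ a * y p ^ b :=
  exists_eq_pow_mul_pow y_mul_x (pow_pos hp.pos 2) x_pow y_pow closure_eq_top g

lemma exists_y_hom (p : ℕ) : ∃ f : L2 p →* Multiplicative (ZMod (p ^ 2)),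
    f (x p) = 1 ∧ f (y p) = Multiplicative.ofAdd 1 := by
  refine exists_hom (one_pow _) ?_ (by simp)
  rw [← ofAdd_nsmul]
  simp only [nsmul_eq_mul, CharP.cast_eq_zero, mul_one, ofAdd_zero]

lemma x_pow_eq_one_iff {a : ℕ} : x p ^ a = 1 ↔ p ^ 2 ∣ a := by
  refine ⟨fun h => ?_, fun ⟨c, hc⟩ => by rw [hc, pow_mul, x_pow, one_pow]⟩
  have h0 : (p : ZMod (p ^ 2)) ^ 2 = 0 := by exact_mod_cast CharP.cast_eq_zero (ZMod (p ^ 2)) _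
  let u : (ZMod (p ^ 2))ˣ := ⟨1 + p, 1 - p, by linear_combination -h0, by linear_combination -h0⟩
  have hu : u ^ p ^ 2 = 1 := by
    ext
    rw [Units.val_pow_eq_pow_val, one_add_pow_of_sq_eq_zero h0]
    push_cast
    linear_combination (p : ZMod (p ^ 2)) * h0
  have hadd : ∀ (k : ℕ) (t : ZMod (p ^ 2)), (Equiv.addLeft (1 : ZMod (p ^ 2)) ^ k) t = k + t := by
    intro k
    induction k with
    | zero => simp
    | succ k ih =>
      intro t
      rw [pow_succ _ k, Equiv.Perm.mul_apply, ih]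
      simp [add_assoc]
  obtain ⟨f, hx, -⟩ := exists_hom (p := p) (u := Equiv.addLeft (1 : ZMod (p ^ 2)))
    (v := MulAction.toPermHom (ZMod (p ^ 2))ˣ (ZMod (p ^ 2)) u) (by ext t; rw [hadd]; simp)
    (by rw [← map_pow, hu, map_one])
    (by
      ext1 t
      simp only [Equiv.Perm.mul_apply, hadd, Equiv.coe_addLeft, MulAction.toPermHom_apply,
        MulAction.toPerm_apply, Units.smul_def, smul_eq_mul, u]
      push_cast
      ring)
  have := congrArg (fun g => f g 0) h
  simp only [map_pow, hx, hadd, map_one, Equiv.Perm.one_apply, add_zero] at this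
  exact (ZMod.natCast_eq_zero_iff _ _).mp this

lemma dvd_of_x_pow_mul_y_pow_eq_one {n a b : ℕ} (h : (x p ^ a * y p ^ b) ^ n = 1) :
    p ^ 2 ∣ b * n := by
  obtain ⟨f, hx, hy⟩ := exists_y_hom p
  have := congrArg f h
  rw [map_pow, map_mul, map_pow, map_pow, hx, hy, one_pow, one_mul, map_one f, ← pow_mul,
    ← ofAdd_nsmul, ofAdd_eq_one, nsmul_one] at this
  exact (ZMod.natCast_eq_zero_iff _ _).mp this

lemma card (hp : p.Prime) : Nat.card (L2 p) = p ^ 4 := by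
  have : NeZero p := ⟨hp.ne_zero⟩
  obtain ⟨f, hx, hy⟩ := exists_y_hom p
  let F : Fin (p ^ 2) × Fin (p ^ 2) → L2 p := fun q => x p ^ (q.1 : ℕ) * y p ^ (q.2 : ℕ)
  have hF : Function.Bijective F := by
    constructor
    · rintro ⟨a, b⟩ ⟨c, d⟩ h
      have hbd : b = d := by
        have := congrArg f h
        simp only [F, map_mul, map_pow, hx, hy, one_pow, one_mul, ← ofAdd_nsmul, nsmul_one] at this
        have := (ZMod.natCast_eq_natCast_iff' _ _ _).mp (Multiplicative.ofAdd.injective this)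
        rw [Nat.mod_eq_of_lt b.2, Nat.mod_eq_of_lt d.2] at this
        exact Fin.ext this
      subst hbd
      have hac : x p ^ (a : ℕ) = x p ^ (c : ℕ) := mul_right_cancel h
      have ho : orderOf (x p) = p ^ 2 :=
        Nat.dvd_antisymm (orderOf_dvd_of_pow_eq_one x_pow)
          (x_pow_eq_one_iff.mp (pow_orderOf_eq_one _))
      rw [pow_inj_mod, ho, Nat.mod_eq_of_lt a.2, Nat.mod_eq_of_lt c.2] at hac
      rw [Fin.ext hac]
    · intro g
      obtain ⟨a, ha, b, hb, rfl⟩ := exists_eq hp g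
      exact ⟨(⟨a, ha⟩, ⟨b, hb⟩), rfl⟩
  rw [← Nat.card_eq_of_bijective F hF]
  simp
  ring

lemma y_pow_commute_x : Commute (y p ^ p) (x p) := by
  have h := pow_mul_pow_of_mul_eq (y_mul_x (p := p)) 1 p
  have h0 : ((p : ZMod (p ^ 2))) ^ 2 = 0 := by exact_mod_cast CharP.cast_eq_zero (ZMod (p ^ 2)) _
  have hm : (p + 1) ^ p ≡ 1 [MOD p ^ 2] := by
    rw [← ZMod.natCast_eq_natCast_iff]
    push_cast
    rw [add_comm, one_add_pow_of_sq_eq_zero h0]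
    linear_combination h0
  have hx : x p ^ (p + 1) ^ p = x p := by
    conv_rhs => rw [← pow_one (x p)]
    rw [pow_eq_pow_iff_modEq]
    exact hm.of_dvd (orderOf_dvd_of_pow_eq_one x_pow)
  rwa [pow_one, one_mul, hx] at h

lemma x_pow_commute_y : Commute (x p ^ p) (y p) := by
  have h := pow_mul_pow_of_mul_eq (y_mul_x (p := p)) p 1
  rw [pow_one, pow_one, mul_add, mul_one, ← sq, pow_add, x_pow, one_mul] at h
  exact h.symm

lemma mem_center_of_pow_eq_one (hp : p.Prime) {g : L2 p} (hg : g ^ p = 1) :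
    g ∈ Subgroup.center (L2 p) := by
  obtain ⟨a, -, b, -, rfl⟩ := exists_eq hp g
  have hb := dvd_of_x_pow_mul_y_pow_eq_one hg
  rw [sq] at hb
  obtain ⟨b, rfl⟩ := Nat.dvd_of_mul_dvd_mul_right hp.pos hb
  have hcomm : Commute (x p ^ a) (y p ^ (p * b)) := by
    rw [pow_mul]
    exact (y_pow_commute_x.symm.pow_left a).pow_right b
  rw [hcomm.mul_pow, ← pow_mul (y p), mul_right_comm, ← sq, pow_mul (y p), y_pow, one_pow,
    mul_one, ← pow_mul, x_pow_eq_one_iff, sq] at hg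
  obtain ⟨a, rfl⟩ := Nat.dvd_of_mul_dvd_mul_right hp.pos hg
  have hx : ∀ z, Commute z (x p) → Commute z (y p) → z ∈ Subgroup.center (L2 p) := by
    intro z hzx hzy
    rw [Subgroup.mem_center_iff]
    intro g
    obtain ⟨c, -, d, -, rfl⟩ := exists_eq hp g
    exact ((hzx.pow_right c).mul_right (hzy.pow_right d)).symm
  refine mul_mem (hx _ ?_ ?_) (hx _ ?_ ?_)
  · exact Commute.pow_left rfl _
  · rw [pow_mul]; exact x_pow_commute_y.pow_left _
  · rw [pow_mul]; exact y_pow_commute_x.pow_left _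
  · exact Commute.pow_left rfl _

end L2

section Commutator

open scoped commutatorElement

/-- If all commutators `⁅g, h⁆` are central, then `h ↦ ⁅g, h⁆` is a homomorphism. -/
def commutatorHom {G : Type*} [Group G] (g : G) (hg : ∀ h, ⁅g, h⁆ ∈ Subgroup.center G) :
    G →* Subgroup.center G :=
  MonoidHom.mk' (fun h => ⟨⁅g, h⁆, hg h⟩) fun h k => by
    have := Subgroup.mem_center_iff.mp (hg k) h
    apply Subtype.ext
    simp only [commutatorElement_def, Subgroup.coe_mul] at *
    calc g * (h * k) * g⁻¹ * (h * k)⁻¹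
        = g * h * g⁻¹ * (g * k * g⁻¹ * k⁻¹) * h⁻¹ := by group
      _ = g * h * g⁻¹ * h⁻¹ * (h * (g * k * g⁻¹ * k⁻¹)) * h⁻¹ := by group
      _ = _ := by rw [this]; group

lemma commutatorHom_ker {G : Type*} [Group G] (g : G) (hg : ∀ h, ⁅g, h⁆ ∈ Subgroup.center G) :
    (commutatorHom g hg).ker = Subgroup.centralizer {g} := by
  ext h
  rw [MonoidHom.mem_ker, Subgroup.mem_centralizer_singleton_iff, Subtype.ext_iff]
  change ⁅g, h⁆ = 1 ↔ _
  rw [commutatorElement_eq_one_iff_mul_comm]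
  exact eq_comm

lemma commutatorHom_pow {G : Type*} [Group G] (g : G) (hg : ∀ h, ⁅g, h⁆ ∈ Subgroup.center G)
    {n : ℕ} (hn : g ^ n ∈ Subgroup.center G) (h : G) : commutatorHom g hg h ^ n = 1 := by
  apply Subtype.ext
  change ⁅g, h⁆ ^ n = 1
  have hc : Commute ⁅g, h⁆ (h * g * h⁻¹) := ((Subgroup.mem_center_iff.mp (hg h)) _).symm
  have h1 : ⁅g, h⁆ * (h * g * h⁻¹) = g := by rw [commutatorElement_def]; group
  have h2 := hc.mul_pow n
  rw [h1, conj_pow, Subgroup.mem_center_iff.mp hn, mul_inv_cancel_right] at h2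
  exact (right_eq_mul.mp h2)

end Commutator

lemma ncard_conj_eq_index {G : Type*} [Group G] (g : G) :
    {y : G | ∃ h : G, y = h⁻¹ * g * h}.ncard = (Subgroup.centralizer {g}).index := by
  have h := MulAction.index_stabilizer (ConjAct G) g
  rw [ConjAct.stabilizer_eq_centralizer] at h
  refine Eq.trans ?_ h.symm
  congr 1
  ext y
  rw [ConjAct.mem_orbit_conjAct, isConj_comm, isConj_iff]
  constructor
  · rintro ⟨h, rfl⟩
    exact ⟨h⁻¹, by group⟩
  · rintro ⟨h, rfl⟩
    exact ⟨h⁻¹, by group⟩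

section Main

open scoped commutatorElement

variable {G : Type*} [Group G] {p : ℕ} {f : G →* L2 p}

lemma commutator_mem_center (hp : p.Prime) (hker : f.ker = Subgroup.center G) {g : G}
    (hg : f g ^ p = 1) (h : G) : ⁅g, h⁆ ∈ Subgroup.center G := by
  rw [← hker, MonoidHom.mem_ker, map_commutatorElement, commutatorElement_eq_one_iff_mul_comm]
  exact (Subgroup.mem_center_iff.mp (L2.mem_center_of_pow_eq_one hp hg) _).symm

lemma pow_mem_center (hker : f.ker = Subgroup.center G) {g : G} (hg : f g ^ p = 1) :
    g ^ p ∈ Subgroup.center G := by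
  rw [← hker, MonoidHom.mem_ker, map_pow, hg]

lemma dvd_card_center [Finite G] (hp : p.Prime) (hf : Function.Surjective f)
    (hker : f.ker = Subgroup.center G) : p ∣ Nat.card (Subgroup.center G) := by
  obtain ⟨g, hg⟩ := hf (L2.x p ^ p)
  have hgp : f g ^ p = 1 := by rw [hg, ← pow_mul, ← sq, L2.x_pow]
  let c := commutatorHom g (commutator_mem_center hp hker hgp)
  have hne : ∃ h, c h ≠ 1 := by
    by_contra! hc
    have hgc : g ∈ Subgroup.center G := by
      rw [Subgroup.mem_center_iff]
      intro h
      have : h ∈ c.ker := hc h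
      rw [commutatorHom_ker, Subgroup.mem_centralizer_singleton_iff] at this
      exact this
    rw [← hker, MonoidHom.mem_ker, hg, L2.x_pow_eq_one_iff, sq] at hgc
    have := Nat.le_of_dvd hp.pos hgc
    nlinarith [hp.two_le]
  obtain ⟨h, hh⟩ := hne
  have := Fact.mk hp
  have ho := orderOf_eq_prime (commutatorHom_pow g _ (pow_mem_center hker hgp) h) hh
  exact ho.symm.dvd.trans (orderOf_dvd_natCard _)

lemma index_centralizer_le [Finite G] (hp : p.Prime) (hf : Function.Surjective f)
    (hker : f.ker = Subgroup.center G) (g : G) :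
    (Subgroup.centralizer {g}).index ≤ p ^ 2 := by
  have : NeZero p := ⟨hp.ne_zero⟩
  by_cases hgp : f g ^ p = 1
  · let c := commutatorHom g (commutator_mem_center hp hker hgp)
    have hcp : ∀ h, c h ^ p = 1 := commutatorHom_pow g _ (pow_mem_center hker hgp)
    obtain ⟨X, hX⟩ := hf (L2.x p)
    obtain ⟨Y, hY⟩ := hf (L2.y p)
    rw [← commutatorHom_ker g (commutator_mem_center hp hker hgp), Subgroup.index_ker]
    let F : Fin p × Fin p → Subgroup.center G := fun q => c X ^ (q.1 : ℕ) * c Y ^ (q.2 : ℕ)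
    have hsub : (c.range : Set (Subgroup.center G)) ⊆ Set.range F := by
      rintro _ ⟨h, rfl⟩
      obtain ⟨a, -, b, -, hab⟩ := L2.exists_eq hp (f h)
      refine ⟨(⟨a % p, Nat.mod_lt _ hp.pos⟩, ⟨b % p, Nat.mod_lt _ hp.pos⟩), ?_⟩
      have hz : (X ^ a * Y ^ b)⁻¹ * h ∈ c.ker := by
        rw [commutatorHom_ker]
        apply Subgroup.center_le_centralizer
        rw [← hker, MonoidHom.mem_ker, map_mul, map_inv, map_mul, map_pow, map_pow, hX, hY, hab,
          inv_mul_cancel]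
      rw [MonoidHom.mem_ker, map_mul, map_inv, inv_mul_eq_one, map_mul, map_pow, map_pow] at hz
      rw [← hz, pow_eq_pow_mod a (hcp X), pow_eq_pow_mod b (hcp Y)]
    calc Nat.card c.range ≤ Nat.card (Set.range F) := Nat.card_mono (Set.toFinite _) hsub
      _ ≤ Nat.card (Fin p × Fin p) := Finite.card_range_le F
      _ = p ^ 2 := by simp [sq]
  · have hle : f.ker ≤ Subgroup.centralizer {g} := hker ▸ Subgroup.center_le_centralizer _
    have hcard := Subgroup.card_mul_index ((Subgroup.centralizer {g}).map f)
    rw [Subgroup.index_map_eq _ hf hle, L2.card hp] at hcard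
    have hfin : Finite (L2 p) := Finite.of_surjective f hf
    obtain ⟨j, -, hj⟩ := (Nat.dvd_prime_pow hp).mp (L2.card hp ▸ orderOf_dvd_natCard (f g))
    have hj2 : 2 ≤ j := by
      by_contra! hlt
      exact hgp (orderOf_dvd_iff_pow_eq_one.mp (hj ▸ pow_dvd_pow p (by omega : j ≤ 1) |>.trans
        (by simp)))
    have hmem : f g ∈ (Subgroup.centralizer {g}).map f :=
      Subgroup.mem_map_of_mem f (Subgroup.mem_centralizer_singleton_iff.mpr rfl)
    have hdvd : p ^ 2 ∣ Nat.card ((Subgroup.centralizer {g}).map f) :=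
      ((pow_dvd_pow p hj2).trans hj.symm.dvd).trans (Subgroup.orderOf_dvd_natCard _ hmem)
    have := Nat.le_of_dvd Nat.card_pos hdvd
    by_contra! hlt
    have := Nat.mul_lt_mul_of_le_of_lt this hlt Nat.card_pos
    rw [hcard, ← pow_add] at this
    exact lt_irrefl _ this

lemma index_centralizer_eq [Finite G] (hp : p.Prime) (hf : Function.Surjective f)
    (hker : f.ker = Subgroup.center G) {g : G} (hg : g ∉ Subgroup.center G) :
    (Subgroup.centralizer {g}).index = p ∨ (Subgroup.centralizer {g}).index = p ^ 2 := by
  have hle : f.ker ≤ Subgroup.centralizer {g} := hker ▸ Subgroup.center_le_centralizer _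
  have hdvd := ((Subgroup.centralizer {g}).map f).index_dvd_card
  rw [Subgroup.index_map_eq _ hf hle, L2.card hp] at hdvd
  obtain ⟨k, -, hk⟩ := (Nat.dvd_prime_pow hp).mp hdvd
  have hk2 : k ≤ 2 := (Nat.pow_le_pow_iff_right hp.one_lt).mp
    (hk ▸ index_centralizer_le hp hf hker g)
  have hk0 : k ≠ 0 := by
    rintro rfl
    rw [pow_zero, Subgroup.index_eq_one] at hk
    refine hg (Subgroup.mem_center_iff.mpr fun h => ?_)
    exact Subgroup.mem_centralizer_singleton_iff.mp (hk ▸ Subgroup.mem_top h)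
  rw [hk]
  obtain rfl | rfl : k = 1 ∨ k = 2 := by omega
  · exact Or.inl (pow_one p)
  · exact Or.inr rfl

end Main

/-- Let `p` be an odd prime and `G` a finite group with `G/Z(G)` isomorphic to the
nonabelian group `⟨x, y | x^(p²) = y^(p²) = 1, y x = x^(p+1) y⟩`. Then `p` divides
`|Z|`, and every conjugacy class of a noncentral element has cardinality `p` or `p²`. -/
theorem conjClass_card_of_nonabelian_quotient {G : Type*} [Group G] [Fintype G]
    (p : ℕ) (hp : p.Prime) (hodd : Odd p)
    (hiso : Nonempty ((G ⧸ Subgroup.center G) ≃* L2 p)) :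
    p ∣ Nat.card (Subgroup.center G) ∧
    ∀ x : G, x ∉ Subgroup.center G →
      {y : G | ∃ g : G, y = g⁻¹ * x * g}.ncard = p ∨
      {y : G | ∃ g : G, y = g⁻¹ * x * g}.ncard = p ^ 2 := by
  obtain ⟨e⟩ := hiso
  let f : G →* L2 p := e.toMonoidHom.comp (QuotientGroup.mk' (Subgroup.center G))
  have hf : Function.Surjective f := e.surjective.comp (QuotientGroup.mk'_surjective _)
  have hker : f.ker = Subgroup.center G := by
    ext g
    simp [f]
  refine ⟨dvd_card_center hp hf hker, fun x hx => ?_⟩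
  rw [ncard_conj_eq_index]
  exact index_centralizer_eq hp hf hker hx
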